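/- arXiv:1907.07025 — 3 statements merged into one kernel-verified Lean document; each statement's English description precedes it below -/
import Mathlib

section
/- Let G be a 2-acyclic Cayley group with generator set E and let v_1, …, v_k ∈ G. Then there exists α_0 ⊆ E such that [v_1]_{α_0} ∈ ⋂_{1≤i≤k} ⟦v_i⟧ and, for every α ⊆ E, [v_1]_α ∈ ⋂_{1≤i≤k} ⟦v_i⟧ if and only if α_0 ⊆ α. In particular, there is a unique minimal set of generators connecting v_1, …, v_k (denoted gen(v_1,…,v_k)). -/
open scoped Pointwise

section CayleyDefs

variable {G : Type*} [Group G]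

/-- The `α`-coset of `v`, i.e. `v · ⟨α⟩` where `⟨α⟩` is the subgroup generated by `α`. -/
def coset (v : G) (α : Set G) : Set G := {x | v⁻¹ * x ∈ Subgroup.closure α}

/-- `G` together with the generator set `E` is a Cayley group: every element of `E`
is a non-trivial involution and `E` generates `G`. -/
def IsCayley (E : Set G) : Prop :=
  (∀ e ∈ E, e ≠ 1 ∧ e * e = 1) ∧ Subgroup.closure E = ⊤

/-- A coset cycle of length `m` in the Cayley group `G` with generator set `E`. -/
def IsCosetCycle (E : Set G) (m : ℕ) (v : ZMod m → G) (α : ZMod m → Set G) : Prop :=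
  (∀ i, α i ⊆ E) ∧
  (∀ i, (v i)⁻¹ * v (i + 1) ∈ Subgroup.closure (α i)) ∧
  (∀ i, coset (v i) (α (i - 1) ∩ α i) ∩ coset (v (i + 1)) (α i ∩ α (i + 1)) = ∅)

/-- Coset `n`-acyclic: no coset cycle of length `≤ n`. -/
def CosetAcyclic (E : Set G) (n : ℕ) : Prop :=
  ∀ m, 1 ≤ m → m ≤ n → ∀ (v : ZMod m → G) (α : ZMod m → Set G), ¬ IsCosetCycle E m v α

/-- 2-acyclic: no coset cycle of length 2. -/
def TwoAcyclic (E : Set G) : Prop :=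
  ∀ (v : ZMod 2 → G) (α : ZMod 2 → Set G), ¬ IsCosetCycle E 2 v α

/-- Labels of a path of length `ℓ`, where labels with indices outside `1..ℓ` equal `∅`. -/
def extLabel (ℓ : ℕ) (α : ℕ → Set G) (i : ℕ) : Set G :=
  if 1 ≤ i ∧ i ≤ ℓ then α i else ∅

/-- A coset path of length `ℓ ≥ 1` with vertices `v 1, …, v (ℓ+1)` and labels
`α 1, …, α ℓ` (vertices pairwise distinct except possibly `v 1 = v (ℓ+1)`;
convention `α 0 = α (ℓ+1) = ∅`). -/
def IsCosetPath (E : Set G) (ℓ : ℕ) (v : ℕ → G) (α : ℕ → Set G) : Prop :=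
  1 ≤ ℓ ∧
  (∀ i, 1 ≤ i → i ≤ ℓ → α i ⊆ E) ∧
  (∀ i j, 1 ≤ i → i < j → j ≤ ℓ + 1 → v i = v j → i = 1 ∧ j = ℓ + 1) ∧
  (∀ i, 1 ≤ i → i ≤ ℓ → (v i)⁻¹ * v (i + 1) ∈ Subgroup.closure (α i)) ∧
  (∀ i, 1 ≤ i → i ≤ ℓ →
    coset (v i) (extLabel ℓ α (i - 1) ∩ α i) ∩
      coset (v (i + 1)) (α i ∩ extLabel ℓ α (i + 1)) = ∅)

/-- `γ` is the unique minimal generator set connecting `v` and `u`: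
for every `β ⊆ E`, `u ∈ [v]_β` iff `γ ⊆ β`. -/
def IsGen (E : Set G) (v u : G) (γ : Set G) : Prop :=
  γ ⊆ E ∧ ∀ β ⊆ E, (u ∈ coset v β ↔ γ ⊆ β)

/-- The dual hyperedge `⟦v⟧`: all label-tagged cosets `(α, [v]_α)` for `α ⊆ E`. -/
def dedge (E : Set G) (v : G) : Set (Set G × Set G) :=
  {p | p.1 ⊆ E ∧ p.2 = coset v p.1}

/-- The vertex set of the dual hypergraph: all label-tagged cosets. -/
def dualV (E : Set G) : Set (Set G × Set G) :=
  {p | p.1 ⊆ E ∧ ∃ v : G, p.2 = coset v p.1}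

/-- Gaifman adjacency in the dual hypergraph: two distinct vertices lying in a
common hyperedge. -/
def dAdj (E : Set G) (x y : Set G × Set G) : Prop :=
  x ≠ y ∧ ∃ w : G, x ∈ dedge E w ∧ y ∈ dedge E w

/-- `ρ(v,γ) = { (β, [v]_β) : γ ⊆ β ⊆ E }`. -/
def rho (E : Set G) (v : G) (γ : Set G) : Set (Set G × Set G) :=
  {p | γ ⊆ p.1 ∧ p.1 ⊆ E ∧ p.2 = coset v p.1}

/-- A non-`t` coset path for `t = ρ(w,γ)`: a coset path all of whose links `[v_i]_{α_i}`
fail to contain `[w]_γ`. -/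
def IsNonTPath (E : Set G) (w : G) (γ : Set G) (ℓ : ℕ) (v : ℕ → G) (α : ℕ → Set G) : Prop :=
  IsCosetPath E ℓ v α ∧ ∀ i, 1 ≤ i → i ≤ ℓ → ¬ coset w γ ⊆ coset (v i) (α i)

/-- An inner coset path with respect to `g = gen(v 1, v (ℓ+1))`. -/
def IsInnerPath (E : Set G) (g : Set G) (ℓ : ℕ) (v : ℕ → G) (α : ℕ → Set G) : Prop :=
  IsCosetPath E ℓ v α ∧ 2 ≤ ℓ ∧
    ∀ i, 1 ≤ i → i ≤ ℓ → coset (v i) (α i) ⊂ coset (v 1) g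

/-- A non-trivial coset path with respect to `g = gen(v 1, v (ℓ+1))`. -/
def IsNontrivialPath (E : Set G) (g : Set G) (ℓ : ℕ) (v : ℕ → G) (α : ℕ → Set G) : Prop :=
  IsCosetPath E ℓ v α ∧ 2 ≤ ℓ ∧
    ∀ i, 1 ≤ i → i ≤ ℓ → ¬ coset (v 1) g ⊆ coset (v i) (α i)

/-- `n`-conformality of the dual hypergraph: every Gaifman clique of size `≤ n`
is contained in a hyperedge. -/
def NConformal (E : Set G) (n : ℕ) : Prop :=
  ∀ K : Finset (Set G × Set G), K.card ≤ n → (↑K : Set (Set G × Set G)) ⊆ dualV E →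
    (∀ x ∈ K, ∀ y ∈ K, x ≠ y → dAdj E x y) → ∃ w : G, ∀ x ∈ K, x ∈ dedge E w

/-- `n`-chordality of the dual hypergraph: every Gaifman cycle of length `> 3`
and `≤ n` has a chord. -/
def NChordal (E : Set G) (n : ℕ) : Prop :=
  ∀ m, 4 ≤ m → m ≤ n → ∀ c : ZMod m → Set G × Set G, Function.Injective c →
    (∀ i, c i ∈ dualV E) → (∀ i, dAdj E (c i) (c (i + 1))) →
    ∃ i j : ZMod m, i ≠ j ∧ j ≠ i + 1 ∧ i ≠ j + 1 ∧ dAdj E (c i) (c j)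

/-- A walk of length `k` in the Gaifman graph of the dual hypergraph restricted to
the complement of `t = ρ(v,γ)`, from a vertex of `⟦v⟧ \ t` to a vertex of `⟦u⟧ \ t`. -/
def HWalk (E : Set G) (v : G) (γ : Set G) (u : G) (k : ℕ) (c : ℕ → Set G × Set G) : Prop :=
  c 0 ∈ dedge E v ∧ c k ∈ dedge E u ∧
  (∀ i ≤ k, c i ∈ dualV E ∧ c i ∉ rho E v γ) ∧
  ∀ i < k, dAdj E (c i) (c (i + 1))

/-- The sequence of dual-hypergraph vertices induced by a coset path:
`(∅,[v 1]_∅), (α 1, [v 2]_{α 1}), …, (α ℓ, [v (ℓ+1)]_{α ℓ}), (∅, [v (ℓ+1)]_∅)`. -/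
def pathVert (ℓ : ℕ) (v : ℕ → G) (α : ℕ → Set G) (i : ℕ) : Set G × Set G :=
  if i = 0 then (∅, coset (v 1) ∅)
  else if i ≤ ℓ then (α i, coset (v (i + 1)) (α i))
  else (∅, coset (v (ℓ + 1)) ∅)

end CayleyDefs


/-- An element of the subgroup generated by `s` lies in the subgroup generated by finitely many
elements of `s`. -/
theorem exists_finset_mem_closure {G : Type*} [Group G] {s : Set G} {g : G}
    (hg : g ∈ Subgroup.closure s) :
    ∃ t : Finset G, (t : Set G) ⊆ s ∧ g ∈ Subgroup.closure (t : Set G) := by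
  classical
  induction hg using Subgroup.closure_induction with
  | mem x hx => exact ⟨{x}, by simpa using hx, Subgroup.subset_closure (by simp)⟩
  | one => exact ⟨∅, by simp, one_mem _⟩
  | mul x y _ _ hx hy =>
    obtain ⟨t, ht, hxt⟩ := hx
    obtain ⟨u, hu, hyu⟩ := hy
    refine ⟨t ∪ u, by simp [ht, hu], mul_mem ?_ ?_⟩
    · exact Subgroup.closure_mono (by simp) hxt
    · exact Subgroup.closure_mono (by simp) hyu
  | inv x _ hx =>
    obtain ⟨t, ht, hxt⟩ := hx
    exact ⟨t, ht, inv_mem hxt⟩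

/-- In a 2-acyclic group, intersecting generator sets intersects the generated subgroups. -/
theorem TwoAcyclic.mem_closure_inter {G : Type*} [Group G] {E : Set G} (h2 : TwoAcyclic E)
    {α β : Set G} (hα : α ⊆ E) (hβ : β ⊆ E) {g : G} (hgα : g ∈ Subgroup.closure α)
    (hgβ : g ∈ Subgroup.closure β) : g ∈ Subgroup.closure (α ∩ β) := by
  by_contra hg
  have disj : coset 1 (α ∩ β) ∩ coset g (α ∩ β) = ∅ := by
    refine Set.eq_empty_of_forall_notMem fun x ⟨hx₁, hxg⟩ => hg ?_
    have hx : x ∈ Subgroup.closure (α ∩ β) := by simpa [coset] using hx₁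
    have hgx : g⁻¹ * x ∈ Subgroup.closure (α ∩ β) := hxg
    simpa using mul_mem hx (inv_mem hgx)
  refine h2 ![1, g] ![α, β] ⟨?_, ?_, ?_⟩
  · exact Fin.forall_fin_two.2 ⟨hα, hβ⟩
  · refine Fin.forall_fin_two.2 ⟨?_, ?_⟩
    · change (1 : G)⁻¹ * g ∈ Subgroup.closure α
      simpa using hgα
    · change g⁻¹ * 1 ∈ Subgroup.closure β
      simpa using hgβ
  · refine Fin.forall_fin_two.2 ⟨?_, ?_⟩
    · change coset 1 (β ∩ α) ∩ coset g (α ∩ β) = ∅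
      rwa [Set.inter_comm β α]
    · change coset g (α ∩ β) ∩ coset 1 (β ∩ α) = ∅
      rwa [Set.inter_comm β α, Set.inter_comm]

/-- In a 2-acyclic Cayley group, every element has a least set of generators producing it. -/
theorem TwoAcyclic.exists_least_closure {G : Type*} [Group G] {E : Set G} (h2 : TwoAcyclic E)
    {g : G} (hg : g ∈ Subgroup.closure E) :
    ∃ γ ⊆ E, ∀ α ⊆ E, g ∈ Subgroup.closure α ↔ γ ⊆ α := by
  classical
  obtain ⟨t, ⟨htE, hgt⟩, hmin⟩ := exists_minimal_of_wellFoundedLT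
    (fun t : Finset G => (t : Set G) ⊆ E ∧ g ∈ Subgroup.closure (t : Set G))
    (exists_finset_mem_closure hg)
  refine ⟨t, htE, fun α hα => ⟨fun hgα => ?_, fun h => Subgroup.closure_mono h hgt⟩⟩
  have hcoe : ((t.filter (· ∈ α) : Finset G) : Set G) = ↑t ∩ α := by ext; simp
  have hle := hmin (y := t.filter (· ∈ α))
    ⟨hcoe ▸ Set.inter_subset_left.trans htE, hcoe ▸ h2.mem_closure_inter htE hα hgt hgα⟩
    (Finset.filter_subset _ _)
  exact fun x hx => (Finset.mem_filter.1 (hle hx)).2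

/-- in a 2-acyclic Cayley group, the set `⋂ i ⟦v_i⟧` has a least element:
there is `α₀ ⊆ E` with `[v_1]_{α₀} ∈ ⋂ i ⟦v_i⟧` and, for all `α ⊆ E`,
`[v_1]_α ∈ ⋂ i ⟦v_i⟧ ↔ α₀ ⊆ α` (here `[v_1]_α ∈ ⟦v_i⟧` means `v_i ∈ [v_1]_α`). -/
theorem exists_minimal_gen {G : Type*} [Group G] (E : Set G) (hC : IsCayley E)
    (h2 : TwoAcyclic E) (k : ℕ) (hk : 1 ≤ k) (vs : Fin k → G) :
    ∃ α₀ : Set G, α₀ ⊆ E ∧ (∀ i, vs i ∈ coset (vs ⟨0, hk⟩) α₀) ∧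
      ∀ α : Set G, α ⊆ E → ((∀ i, vs i ∈ coset (vs ⟨0, hk⟩) α) ↔ α₀ ⊆ α) := by
  have hE (i : Fin k) : (vs ⟨0, hk⟩)⁻¹ * vs i ∈ Subgroup.closure E := hC.2 ▸ Subgroup.mem_top _
  choose γ hγE hγ using fun i => h2.exists_least_closure (hE i)
  have key (α : Set G) (hα : α ⊆ E) :
      (∀ i, vs i ∈ coset (vs ⟨0, hk⟩) α) ↔ ⋃ i, γ i ⊆ α :=
    (forall_congr' fun i => hγ i α hα).trans Set.iUnion_subset_iff.symm
  have hsub : ⋃ i, γ i ⊆ E := Set.iUnion_subset hγE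
  exact ⟨⋃ i, γ i, hsub, (key _ hsub).2 subset_rfl, key⟩
end

section
/- Let G be a 2-acyclic Cayley group with generator set E. Then for every v ∈ G and all α, β ⊆ E: β ⊆ α if and only if [v]_β ⊆ [v]_α. -/
open scoped Pointwise

theorem coset_mono {G : Type*} [Group G] (v : G) {α β : Set G} (h : β ⊆ α) : coset v β ⊆ coset v α :=
  fun _ hx => Subgroup.closure_mono h hx

theorem coset_empty {G : Type*} [Group G] (v : G) : coset v ∅ = {v} := by
  ext x
  simp [coset, inv_mul_eq_one, eq_comm]

/-- In a 2-acyclic group, a generator lying in the subgroup generated by `α` belongs to `α`: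
otherwise `1` and `e` span a coset cycle of length 2 with labels `{e}` and `α`. -/
theorem TwoAcyclic.mem_of_mem_closure {G : Type*} [Group G] {E : Set G} (h2 : TwoAcyclic E) {α : Set G}
    (hα : α ⊆ E) {e : G} (he : e ∈ E) (he1 : e ≠ 1) (hmem : e ∈ Subgroup.closure α) :
    e ∈ α := by
  by_contra hne
  have hdisj : {e} ∩ α = ∅ := Set.singleton_inter_eq_empty.mpr hne
  have hdisj' : α ∩ {e} = ∅ := by rw [Set.inter_comm, hdisj]
  have h01 : (0 : ZMod 2) - 1 = 1 := by decide
  have h11 : (1 : ZMod 2) + 1 = 0 := by decide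
  have h10 : (1 : ZMod 2) ≠ 0 := by decide
  refine h2 (fun i => if i = 0 then 1 else e) (fun i => if i = 0 then {e} else α) ⟨?_, ?_, ?_⟩ <;>
    intro i <;> obtain rfl | rfl : i = 0 ∨ i = 1 := by decide +revert
  · simpa using he
  · simpa using hα
  · simp
  · simpa [h11] using hmem
  · simp [h01, hdisj, hdisj', coset_empty, he1.symm]
  · simp [h11, hdisj, hdisj', coset_empty, he1]

/-- in a 2-acyclic Cayley group, for all `v ∈ G` and `α, β ⊆ E`:
`β ⊆ α ↔ [v]_β ⊆ [v]_α`. -/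
theorem subset_iff_coset_subset {G : Type*} [Group G] (E : Set G) (hC : IsCayley E)
    (h2 : TwoAcyclic E) (v : G) (α β : Set G) (hα : α ⊆ E) (hβ : β ⊆ E) :
    β ⊆ α ↔ coset v β ⊆ coset v α := by
  refine ⟨coset_mono v, fun h e he => ?_⟩
  refine h2.mem_of_mem_closure hα (hβ he) (hC.1 e (hβ he)).1 ?_
  have hv : v * e ∈ coset v β := by simpa [coset] using Subgroup.subset_closure he
  simpa [coset] using h hv
end

section
/- Let G be a coset 2n-acyclic Cayley group with generator set E and let v, u ∈ G. If there are two coset paths from v to u of lengths ℓ, k ≤ n whose first labels are α_1 and β_1 respectively, then there is a coset path from v to u of length ≤ n whose first label is α_1 ∩ β_1. -/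
open scoped Pointwise

section CosetPaths

variable {G : Type*} [Group G] {E : Set G}

lemma mem_coset_iff {v w : G} {α : Set G} : w ∈ coset v α ↔ v⁻¹ * w ∈ Subgroup.closure α :=
  Iff.rfl

lemma mem_coset_self (v : G) (α : Set G) : v ∈ coset v α := by
  simp [mem_coset_iff]

lemma mem_coset_symm {v w : G} {α : Set G} (h : w ∈ coset v α) : v ∈ coset w α := by
  simpa [mem_coset_iff] using inv_mem (mem_coset_iff.1 h)

lemma mem_coset_trans {v w x : G} {α : Set G} (h : w ∈ coset v α) (h' : x ∈ coset w α) :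
    x ∈ coset v α := by
  have := mul_mem (mem_coset_iff.1 h) (mem_coset_iff.1 h')
  simpa [mem_coset_iff, mul_assoc] using this

lemma mem_coset_mono {v w : G} {α β : Set G} (h : w ∈ coset v α) (hs : α ⊆ β) :
    w ∈ coset v β :=
  Subgroup.closure_mono hs h

lemma mem_coset_left {v w : G} {α β : Set G} (h : w ∈ coset v (α ∩ β)) : w ∈ coset v α :=
  mem_coset_mono h Set.inter_subset_left

lemma mem_coset_right {v w : G} {α β : Set G} (h : w ∈ coset v (α ∩ β)) : w ∈ coset v β :=
  mem_coset_mono h Set.inter_subset_right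

lemma mem_coset_comm {v w : G} {α β : Set G} (h : w ∈ coset v (α ∩ β)) :
    w ∈ coset v (β ∩ α) := by
  rwa [Set.inter_comm]

lemma mem_coset_empty {v w : G} : w ∈ coset v ∅ ↔ w = v := by
  rw [mem_coset_iff, Subgroup.closure_empty, Subgroup.mem_bot, inv_mul_eq_one, eq_comm]

/-- A coset path with vertices `s 0, …, s ℓ` and labels `a 0, …, a (ℓ - 1)`, whose vertices
are not required to be distinct. -/
structure IsWeakPath (E : Set G) (ℓ : ℕ) (s : ℕ → G) (a : ℕ → Set G) : Prop where
  sub : ∀ i, i < ℓ → a i ⊆ E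
  link : ∀ i, i < ℓ → s (i + 1) ∈ coset (s i) (a i)
  mid : ∀ i z, i + 2 < ℓ → z ∈ coset (s (i + 1)) (a i ∩ a (i + 1)) →
    z ∉ coset (s (i + 2)) (a (i + 1) ∩ a (i + 2))
  first : 2 ≤ ℓ → s 0 ∉ coset (s 1) (a 0 ∩ a 1)
  last : ∀ i, ℓ = i + 2 → s (i + 2) ∉ coset (s (i + 1)) (a i ∩ a (i + 1))
  single : ℓ = 1 → s 0 ≠ s 1

lemma IsCosetPath.isWeakPath {ℓ : ℕ} {t : ℕ → G} {α : ℕ → Set G} (h : IsCosetPath E ℓ t α) :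
    IsWeakPath E ℓ (fun i => t (i + 1)) (fun i => α (i + 1)) := by
  obtain ⟨hℓ, hE, -, hl, hs⟩ := h
  refine ⟨fun i hi => hE _ (by omega) (by omega), fun i hi => hl _ (by omega) (by omega),
    fun i z hi hz hz' => ?_, fun h2 hz => ?_, fun i hi hz => ?_, fun h1 hz => ?_⟩
  · have := hs (i + 2) (by omega) (by omega)
    simp only [extLabel] at this
    rw [if_pos (by omega), if_pos (by omega)] at this
    exact Set.eq_empty_iff_forall_notMem.1 this z ⟨hz, hz'⟩
  · have := hs 1 (by omega) (by omega)
    simp only [extLabel] at this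
    rw [if_neg (by omega), if_pos (by omega)] at this
    exact Set.eq_empty_iff_forall_notMem.1 this _ ⟨mem_coset_self _ _, hz⟩
  · have := hs (i + 2) (by omega) (by omega)
    simp only [extLabel] at this
    rw [if_pos (by omega), if_neg (by omega)] at this
    exact Set.eq_empty_iff_forall_notMem.1 this _ ⟨hz, mem_coset_self _ _⟩
  · have := hs 1 (by omega) (by omega)
    simp only [extLabel] at this
    rw [if_neg (by omega), if_neg (by omega)] at this
    refine Set.eq_empty_iff_forall_notMem.1 this (t 1) ⟨mem_coset_self _ _, ?_⟩
    simp only [zero_add, Nat.reduceAdd] at hz ⊢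
    rw [hz]
    exact mem_coset_self _ _

/-- Pass to a stretch of a weak path and move its two ends. -/
lemma IsWeakPath.stretch {M ℓ j : ℕ} {s q : ℕ → G} {a : ℕ → Set G} (h : IsWeakPath E M s a)
    (hj : j + ℓ ≤ M) (hℓ : 2 ≤ ℓ) (hq : ∀ i, 1 ≤ i → i < ℓ → q i = s (i + j))
    (h0 : q 0 ∈ coset (s j) (a j)) (h0' : q 0 ∉ coset (s (j + 1)) (a j ∩ a (j + 1)))
    (h1 : q ℓ ∈ coset (s (ℓ + j)) (a (ℓ - 1 + j)))
    (h1' : q ℓ ∉ coset (s (ℓ - 1 + j)) (a (ℓ - 2 + j) ∩ a (ℓ - 1 + j))) :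
    IsWeakPath E ℓ q (fun i => a (i + j)) := by
  obtain ⟨p, rfl⟩ : ∃ p, ℓ = p + 2 := ⟨ℓ - 2, by omega⟩
  simp only [show p + 2 - 1 = p + 1 by omega, show p + 2 - 2 = p by omega] at h1 h1'
  refine ⟨fun i hi => h.sub _ (by omega), fun i hi => ?_, fun i z hi hz hz' => ?_,
    fun h2 hz => ?_, fun i hi hz => ?_, fun h1 => by omega⟩
  · have key := h.link (i + j) (by omega)
    rw [show i + j + 1 = i + 1 + j by omega] at key
    rcases Nat.eq_zero_or_pos i with rfl | hi0
    · rw [hq (0 + 1) (by omega) (by omega)]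
      simp only [zero_add] at key ⊢
      exact mem_coset_trans (mem_coset_symm h0) key
    · rw [hq i (by omega) (by omega)]
      by_cases hi' : i = p + 1
      · subst hi'
        exact mem_coset_trans key h1
      · rwa [hq (i + 1) (by omega) (by omega)]
  · rw [hq _ (by omega) (by omega)] at hz hz'
    have := h.mid (i + j) z (by omega)
    rw [show i + j + 1 = i + 1 + j by omega, show i + j + 2 = i + 2 + j by omega] at this
    exact this hz hz'
  · rw [hq _ (by omega) (by omega)] at hz
    simp only [zero_add, add_comm 1 j] at hz
    exact h0' hz
  · obtain rfl : i = p := by omega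
    rw [hq _ (by omega) (by omega)] at hz
    exact h1' hz

lemma isWeakPath_one {q : ℕ → G} {a : ℕ → Set G} (h : a 0 ⊆ E) (h0 : q 1 ∈ coset (q 0) (a 0))
    (h1 : q 0 ≠ q 1) : IsWeakPath E 1 q a := by
  refine ⟨fun i hi => ?_, fun i hi => ?_, fun i z hi => by omega, fun h => by omega,
    fun i hi => by omega, fun _ => h1⟩ <;>
  · obtain rfl : i = 0 := by omega
    assumption

/-- A closed sequence of links that is not too long violates the separation condition of
coset cycles somewhere. -/
lemma CosetAcyclic.exists_mem_of_closed {N m : ℕ} (hN : CosetAcyclic E N) (hm : 1 ≤ m)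
    (hmN : m ≤ N) {x : ℕ → G} {c : ℕ → Set G} (hx : x m = x 0) (hc : c m = c 0)
    (hE : ∀ i, i < m → c i ⊆ E) (hl : ∀ i, i < m → x (i + 1) ∈ coset (x i) (c i)) :
    (∃ z, z ∈ coset (x 0) (c (m - 1) ∩ c 0) ∧ z ∈ coset (x 1) (c 0 ∩ c 1)) ∨
    ∃ i z, i + 1 < m ∧ z ∈ coset (x (i + 1)) (c i ∩ c (i + 1)) ∧
      z ∈ coset (x (i + 2)) (c (i + 1) ∩ c (i + 2)) := by
  by_contra! hcon
  obtain ⟨hcon0, hcon1⟩ := hcon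
  obtain ⟨p, rfl⟩ : ∃ p, m = p + 1 := ⟨m - 1, by omega⟩
  have fin_succ_val : ∀ i : Fin (p + 1),
      (i + 1).val = if i.val = p then 0 else i.val + 1 := by
    intro i
    rw [Fin.val_add_one]
    simp [Fin.ext_iff]
  have succ_val : ∀ i : ZMod (p + 1), (i + 1).val = if i.val = p then 0 else i.val + 1 :=
    fin_succ_val
  have hxs : ∀ i : ZMod (p + 1), x (i + 1).val = x (i.val + 1) := by
    intro i
    rw [succ_val]
    split_ifs with h
    · rw [h, hx]
    · rfl
  have hcs : ∀ i : ZMod (p + 1), c (i + 1).val = c (i.val + 1) := by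
    intro i
    rw [succ_val]
    split_ifs with h
    · rw [h, hc]
    · rfl
  refine hN (p + 1) hm hmN (fun i => x i.val) (fun i => c i.val)
    ⟨fun i => hE _ (ZMod.val_lt i), fun i => ?_, fun i => ?_⟩
  · simp only [hxs]
    exact hl _ (ZMod.val_lt i)
  · simp only [hxs, hcs]
    rw [Set.eq_empty_iff_forall_notMem]
    rintro z ⟨hz, hz'⟩
    obtain ⟨j, rfl⟩ : ∃ j, i = j + 1 := ⟨i - 1, by ring⟩
    rw [add_sub_cancel_right] at hz
    have hjv := succ_val j
    have hjlt := ZMod.val_lt j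
    split_ifs at hjv with h
    · rw [hjv, h] at hz
      rw [hjv] at hz'
      exact hcon0 z hz hz'
    · rw [hjv] at hz hz'
      exact hcon1 _ z (by omega) hz hz'

lemma IsWeakPath.not_closed {N : ℕ} (hN : CosetAcyclic E N) :
    ∀ (m : ℕ) (s : ℕ → G) (a : ℕ → Set G), 1 ≤ m → m ≤ N → IsWeakPath E m s a → s m ≠ s 0 := by
  intro m
  induction m using Nat.strong_induction_on with
  | _ m ih =>
  intro s a hm hmN h hclosed
  rcases (show m = 1 ∨ 2 ≤ m by omega) with rfl | hm2
  · exact h.single rfl hclosed.symm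
  obtain ⟨p, rfl⟩ : ∃ p, m = p + 2 := ⟨m - 2, by omega⟩
  have hcyc := hN.exists_mem_of_closed (x := s) (c := fun i => if i < p + 2 then a i else a 0)
    hm hmN hclosed (by simp) (fun i hi => by simpa [hi] using h.sub i hi)
    (fun i hi => by simpa [hi] using h.link i hi)
  have hz : ∃ z, z ∈ coset (s 0) (a (p + 1) ∩ a 0) ∧
      (z ∈ coset (s 1) (a 0 ∩ a 1) ∨ z ∈ coset (s (p + 1)) (a p ∩ a (p + 1))) := by
    rcases hcyc with ⟨z, h0, h1⟩ | ⟨i, z, hi, h0, h1⟩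
    · exact ⟨z, by simpa using h0, Or.inl (by simpa using h1)⟩
    · by_cases hip : i = p
      · subst hip
        refine ⟨z, ?_, Or.inr (by simpa using h0)⟩
        rw [← hclosed]
        simpa using h1
      · have e1 : i < p + 2 := by omega
        have e2 : i + 1 < p + 2 := by omega
        have e3 : i + 2 < p + 2 := by omega
        simp only [e1, e2, e3, if_true] at h0 h1
        exact absurd h1 (h.mid i z e3 h0)
  obtain ⟨z, hz0, hz1⟩ := hz
  have hzl : z ∈ coset (s (p + 2)) (a (p + 1)) := hclosed ▸ mem_coset_left hz0
  by_cases hp0 : p = 0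
  · subst hp0
    refine h.first le_rfl ?_
    have hz1' : z ∈ coset (s 1) (a 0 ∩ a 1) := by simpa using hz1
    exact mem_coset_trans hz1' (mem_coset_symm (mem_coset_comm hz0))
  by_cases hS : z ∈ coset (s 1) (a 0 ∩ a 1) <;>
    by_cases hT : z ∈ coset (s (p + 1)) (a p ∩ a (p + 1))
  · by_cases hp1 : p = 1
    · subst hp1
      exact h.mid 0 z (by omega) hS hT
    · have hw := h.stretch (j := 1) (ℓ := p)
        (q := fun i => if i = 0 then z else if i < p then s (i + 1) else z) (by omega) (by omega)
        (fun i hi hi' => by simp [hi', show i ≠ 0 by omega])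
        (by simpa using mem_coset_right hS)
        (by simpa using h.mid 0 z (by omega) hS)
        (by
          simp only [hp0, if_false, lt_irrefl]
          rw [show p - 1 + 1 = p by omega]
          exact mem_coset_left hT)
        (by
          simp only [hp0, if_false, lt_irrefl]
          have := h.mid (p - 1) z (by omega)
          rw [show p - 1 + 1 = p by omega, show p - 1 + 2 = p + 1 by omega] at this
          rw [show p - 1 + 1 = p by omega, show p - 2 + 1 = p - 1 by omega]
          exact fun hh => this hh hT)
      exact ih p (by omega) _ _ (by omega) (by omega) hw (by simp)
  · have hw := h.stretch (j := 1) (ℓ := p + 1)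
        (q := fun i => if i = 0 then z else if i < p + 1 then s (i + 1) else z) (by omega) (by omega)
        (fun i hi hi' => by simp [hi', show i ≠ 0 by omega])
        (by simpa using mem_coset_right hS)
        (by simpa using h.mid 0 z (by omega) hS)
        (by simpa using hzl)
        (by
          simp only [Nat.add_eq_zero_iff, one_ne_zero, and_false, if_false, lt_irrefl,
            Nat.add_sub_cancel]
          rwa [show p + 1 - 2 + 1 = p by omega])
    exact ih (p + 1) (by omega) _ _ (by omega) (by omega) hw (by simp)
  · have hw := h.stretch (j := 0) (ℓ := p + 1)
        (q := fun i => if i = 0 then z else if i < p + 1 then s i else z) (by omega) (by omega)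
        (fun i hi hi' => by simp [hi', show i ≠ 0 by omega])
        (by simpa using mem_coset_right hz0)
        (by simpa using hS)
        (by simpa using mem_coset_left hT)
        (by
          simp only [Nat.add_eq_zero_iff, one_ne_zero, and_false, if_false, lt_irrefl,
            Nat.add_sub_cancel, Nat.add_zero]
          have := h.mid (p - 1) z (by omega)
          rw [show p - 1 + 1 = p by omega, show p - 1 + 2 = p + 1 by omega] at this
          rw [show p + 1 - 2 = p - 1 by omega]
          exact fun hh => this hh hT)
    exact ih (p + 1) (by omega) _ _ (by omega) (by omega) hw (by simp)
  · tauto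

/-- The first link of the path can be shortened to one labelled `γ`. -/
def Shortens (ℓ : ℕ) (s : ℕ → G) (a : ℕ → Set G) (γ : Set G) : Prop :=
  (ℓ = 1 ∧ s 1 ∈ coset (s 0) γ) ∨
    (2 ≤ ℓ ∧ ∃ y ∈ coset (s 0) γ, y ∈ coset (s 1) (a 0 ∩ a 1))

/-- The link of the path that collapses when the path is closed up into a cycle by a
path with first label `b` and last label `e`. -/
def Collapses (ℓ : ℕ) (s : ℕ → G) (a : ℕ → Set G) (b e : Set G) : Prop :=
  (2 ≤ ℓ ∧ ∃ y ∈ coset (s 0) (a 0 ∩ b), y ∈ coset (s 1) (a 0 ∩ a 1)) ∨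
  (∃ i, ℓ = i + 2 ∧ ∃ z ∈ coset (s (i + 1)) (a i ∩ a (i + 1)),
    z ∈ coset (s (i + 2)) (a (i + 1) ∩ e)) ∨
  (ℓ = 1 ∧ ∃ z ∈ coset (s 0) (a 0 ∩ b), z ∈ coset (s 1) (a 0 ∩ e))

lemma collapses_or_collapses {N p k : ℕ} (hN : CosetAcyclic E N) {s r : ℕ → G}
    {a b : ℕ → Set G} (hs : IsWeakPath E (p + 1) s a) (hr : IsWeakPath E (k + 1) r b)
    (hle : p + 1 + (k + 1) ≤ N) (h0 : s 0 = r 0) (h1 : s (p + 1) = r (k + 1)) :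
    Collapses (p + 1) s a (b 0) (b k) ∨ Collapses (k + 1) r b (a 0) (a p) := by
  obtain ⟨x, hxs, hxr⟩ : ∃ x : ℕ → G, (∀ i, i ≤ p + 1 → x i = s i) ∧
      ∀ i j, p + 1 ≤ i → i + j = p + k + 2 → x i = r j := by
    refine ⟨fun i => if i ≤ p + 1 then s i else r (p + k + 2 - i), fun i hi => if_pos hi,
      fun i j hi hj => ?_⟩
    by_cases hip : i = p + 1
    · obtain rfl : j = k + 1 := by omega
      simp [hip, h1]
    · simp only [show ¬ i ≤ p + 1 by omega, if_false]
      congr 1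
      omega
  obtain ⟨c, hca, hcb, hce⟩ : ∃ c : ℕ → Set G, (∀ i, i ≤ p → c i = a i) ∧
      (∀ i j, p < i → i + j = p + k + 1 → c i = b j) ∧ c (p + k + 2) = a 0 := by
    refine ⟨fun i => if i ≤ p then a i else if i < p + k + 2 then b (p + k + 1 - i) else a 0,
      fun i hi => if_pos hi, fun i j hi hj => ?_, ?_⟩
    · simp only [show ¬ i ≤ p by omega, show i < p + k + 2 by omega, if_false, if_true]
      congr 1
      omega
    · simp only [show ¬ p + k + 2 ≤ p by omega, lt_irrefl, if_false]
  have hcyc := hN.exists_mem_of_closed (m := p + k + 2) (x := x) (c := c)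
    (by omega) (by omega) (by rw [hxs 0 (by omega), hxr _ 0 (by omega) (by omega), h0])
    (by rw [hce, hca 0 (by omega)])
    (fun i hi => by
      by_cases hip : i ≤ p
      · rw [hca i hip]
        exact hs.sub _ (by omega)
      · rw [hcb i (p + k + 1 - i) (by omega) (by omega)]
        exact hr.sub _ (by omega))
    (fun i hi => by
      by_cases hip : i ≤ p
      · rw [hca i hip, hxs i (by omega), hxs (i + 1) (by omega)]
        exact hs.link i (by omega)
      · obtain ⟨j, hj⟩ : ∃ j, i + j = p + k + 1 := ⟨p + k + 1 - i, by omega⟩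
        rw [hcb i j (by omega) hj, hxr i (j + 1) (by omega) (by omega),
          hxr (i + 1) j (by omega) (by omega)]
        exact mem_coset_symm (hr.link j (by omega)))
  rcases hcyc with ⟨z, hz, hz'⟩ | ⟨i, z, hi, hz, hz'⟩
  · left
    rw [hxs 0 (by omega), hca 0 (by omega), hcb _ 0 (by omega) (by omega)] at hz
    rw [hxs 1 (by omega), hca 0 (by omega)] at hz'
    by_cases hp : p = 0
    · subst hp
      rw [hcb 1 k (by omega) (by omega)] at hz'
      exact Or.inr (Or.inr ⟨rfl, z, mem_coset_comm hz, hz'⟩)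
    · rw [hca 1 (by omega)] at hz'
      exact Or.inl ⟨by omega, z, mem_coset_comm hz, hz'⟩
  · rcases lt_trichotomy (i + 1) p with hip | hip | hip
    · rw [hxs _ (by omega), hca _ (by omega), hca _ (by omega)] at hz hz'
      exact absurd hz' (hs.mid i z (by omega) hz)
    · subst hip
      rw [hxs _ (by omega), hca i (by omega), hca _ (by omega)] at hz
      rw [hxs _ (by omega), hca _ (by omega), hcb _ k (by omega) (by omega)] at hz'
      exact Or.inl (Or.inr (Or.inl ⟨i, rfl, z, hz, hz'⟩))
    · right
      obtain ⟨d, hd⟩ : ∃ d, i + d = p + k := ⟨p + k - i, by omega⟩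
      rw [hxr _ (d + 1) (by omega) (by omega), hcb (i + 1) d (by omega) (by omega)] at hz
      rw [hxr _ d (by omega) (by omega), hcb (i + 1) d (by omega) (by omega)] at hz'
      have hA : (∃ j, d = j + 1 ∧ z ∈ coset (r (j + 1)) (b (j + 1) ∩ b j)) ∨
          d = 0 ∧ z ∈ coset (r 0) (b 0 ∩ a 0) := by
        rcases d with _ | j
        · rw [show i + 2 = p + k + 2 by omega, hce] at hz'
          exact Or.inr ⟨rfl, hz'⟩
        · rw [hcb _ j (by omega) (by omega)] at hz'
          exact Or.inl ⟨j, rfl, hz'⟩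
      have hB : (d < k ∧ z ∈ coset (r (d + 1)) (b (d + 1) ∩ b d)) ∨
          d = k ∧ z ∈ coset (r (d + 1)) (a p ∩ b d) := by
        by_cases hip' : i = p
        · rw [hip', hca p le_rfl] at hz
          exact Or.inr ⟨by omega, hz⟩
        · rw [hcb i (d + 1) (by omega) (by omega)] at hz
          exact Or.inl ⟨by omega, hz⟩
      rcases hA with ⟨j, rfl, hA⟩ | ⟨rfl, hA⟩ <;> rcases hB with ⟨hdk, hB⟩ | ⟨rfl, hB⟩
      · exact absurd (mem_coset_comm hB) (hr.mid j z (by omega) (mem_coset_comm hA))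
      · exact Or.inr (Or.inl ⟨j, rfl, z, mem_coset_comm hA, mem_coset_comm hB⟩)
      · exact Or.inl ⟨by omega, z, hA, mem_coset_comm hB⟩
      · exact Or.inr (Or.inr ⟨rfl, z, hA, mem_coset_comm hB⟩)

/-- `shortens_or_shortens` for paths of total length less than `M`. -/
def ShortensBelow (E : Set G) (M : ℕ) : Prop :=
  ∀ (p k : ℕ) (s r : ℕ → G) (a b : ℕ → Set G), p + 1 + (k + 1) < M →
    IsWeakPath E (p + 1) s a → IsWeakPath E (k + 1) r b → s 0 = r 0 → s (p + 1) = r (k + 1) →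
    Shortens (p + 1) s a (a 0 ∩ b 0) ∨ Shortens (k + 1) r b (a 0 ∩ b 0)

/-- The end of a weak path moved inside the last link; the last link is dropped when it
becomes redundant. -/
lemma IsWeakPath.exists_move_end {k : ℕ} {r : ℕ → G} {b : ℕ → Set G}
    (hr : IsWeakPath E (k + 1) r b) {z : G} (hz : z ∈ coset (r (k + 1)) (b k)) :
    (k = 0 ∧ z = r 0) ∨
    IsWeakPath E (k + 1) (fun i => if i ≤ k then r i else z) b ∨
    ∃ j, k = j + 1 ∧ z ∈ coset (r (j + 1)) (b j ∩ b (j + 1)) ∧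
      IsWeakPath E (j + 1) (fun i => if i ≤ j then r i else z) b := by
  have drop : ∀ j, j + 2 ≤ k + 1 → z ∈ coset (r (j + 1)) (b j ∩ b (j + 1)) →
      IsWeakPath E (j + 1) (fun i => if i ≤ j then r i else z) b := by
    intro j hj hzj
    rcases Nat.eq_zero_or_pos j with rfl | hj0
    · refine isWeakPath_one (hr.sub 0 (by omega)) ?_ ?_
      · simpa using mem_coset_trans (hr.link 0 (by omega)) (mem_coset_left hzj)
      · rintro he
        simp only [le_refl, if_true, nonpos_iff_eq_zero, one_ne_zero, if_false] at he
        exact hr.first (by omega) (he ▸ hzj)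
    · obtain ⟨i, rfl⟩ : ∃ i, j = i + 1 := ⟨j - 1, by omega⟩
      refine hr.stretch (j := 0) (ℓ := i + 1 + 1) (by omega) (by omega)
        (fun l hl hl' => by simp [show l ≤ i + 1 by omega])
        (by simpa using mem_coset_self _ _) (by simpa using hr.first (by omega))
        (by simpa using mem_coset_left hzj) ?_
      simpa using fun hh => hr.mid i z (by omega) hh hzj
  rcases Nat.eq_zero_or_pos k with rfl | hk0
  · by_cases he : z = r 0
    · exact Or.inl ⟨rfl, he⟩
    · refine Or.inr (Or.inl (isWeakPath_one (hr.sub 0 (by omega)) ?_ ?_))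
      · simpa using mem_coset_trans (hr.link 0 (by omega)) hz
      · simpa using Ne.symm he
  · obtain ⟨j, rfl⟩ : ∃ j, k = j + 1 := ⟨k - 1, by omega⟩
    right
    by_cases hzj : z ∈ coset (r (j + 1)) (b j ∩ b (j + 1))
    · exact Or.inr ⟨j, rfl, hzj, drop j (by omega) hzj⟩
    · refine Or.inl (hr.stretch (j := 0) (ℓ := j + 1 + 1) (by omega) (by omega)
        (fun l hl hl' => by simp [show l ≤ j + 1 by omega])
        (by simpa using mem_coset_self _ _) (by simpa using hr.first (by omega))
        (by simpa using hz) (by simpa using hzj))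

/-- If the last link of the first path collapses, two shorter paths take over. -/
lemma shortens_of_last_collapses {N M i k : ℕ} (hN : CosetAcyclic E N) (hMN : M ≤ N)
    (ih : ShortensBelow E M) {s r : ℕ → G} {a b : ℕ → Set G} (hs : IsWeakPath E (i + 2) s a)
    (hr : IsWeakPath E (k + 1) r b) (hM : i + 2 + (k + 1) = M) (h0 : s 0 = r 0)
    (h1 : s (i + 2) = r (k + 1)) {z : G} (hz : z ∈ coset (s (i + 1)) (a i ∩ a (i + 1)))
    (hz' : z ∈ coset (s (i + 2)) (a (i + 1) ∩ b k)) :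
    Shortens (i + 2) s a (a 0 ∩ b 0) ∨ Shortens (k + 1) r b (a 0 ∩ b 0) := by
  have hsz : IsWeakPath E (i + 1) (fun l => if l ≤ i then s l else z) a := by
    rcases hs.exists_move_end (mem_coset_left hz') with ⟨hi, -⟩ | hw | ⟨j, hj, -, hw⟩
    · omega
    · have := hw.last i rfl
      simp only [le_refl, if_true, show ¬ i + 2 ≤ i + 1 by omega, if_false] at this
      exact absurd hz this
    · obtain rfl : i = j := by omega
      exact hw
  have finish : ∀ {γ}, z ∈ coset (s 0) γ → i = 0 → Shortens (i + 2) s a γ := by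
    rintro γ hγ rfl
    exact Or.inr ⟨le_rfl, z, hγ, hz⟩
  have hsS : ∀ {γ}, Shortens (i + 1) (fun l => if l ≤ i then s l else z) a γ →
      Shortens (i + 2) s a γ := by
    rintro γ (⟨hi, hy⟩ | ⟨hi, y, hy, hy'⟩)
    · obtain rfl : i = 0 := by omega
      exact finish (by simpa using hy) rfl
    · exact Or.inr ⟨by omega, y, by simpa using hy, by simpa [show 1 ≤ i by omega] using hy'⟩
  rcases hr.exists_move_end (z := z) (h1 ▸ mem_coset_right hz') with ⟨-, he⟩ | hw | ⟨j, rfl, hzj, hw⟩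
  · exact absurd (by simp [he, h0]) (IsWeakPath.not_closed hN _ _ _ (by omega) (by omega) hsz)
  · rcases ih i k _ _ a b (by omega) hsz hw (by simpa using h0) (by simp) with hS | hS
    · exact Or.inl (hsS hS)
    · rcases hS with ⟨hk, hy⟩ | ⟨hk, y, hy, hy'⟩
      · obtain rfl : k = 0 := by omega
        left
        have hzγ : z ∈ coset (s 0) (a 0 ∩ b 0) := by simpa [h0] using hy
        by_cases hi : i = 0
        · exact finish hzγ hi
        obtain ⟨j, rfl⟩ : ∃ j, i = j + 1 := ⟨i - 1, by omega⟩
        refine Or.inr ⟨by omega, z, hzγ, ?_⟩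
        by_cases he : z = s 1
        · exact he ▸ mem_coset_self _ _
        have hone : IsWeakPath E 1 (fun l => if l = 0 then s 1 else z) (fun _ => a 0) := by
          refine isWeakPath_one (hs.sub 0 (by omega)) ?_ ?_
          · simpa using mem_coset_trans (mem_coset_symm (hs.link 0 (by omega)))
              (mem_coset_left hzγ)
          · simpa using Ne.symm he
        have htail : IsWeakPath E (j + 1) (fun l => if l ≤ j then s (l + 1) else z)
            (fun l => a (l + 1)) := by
          rcases Nat.eq_zero_or_pos j with rfl | hj
          · refine isWeakPath_one (hs.sub 1 (by omega)) ?_ ?_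
            · simpa using mem_coset_trans (hs.link 1 (by omega)) (mem_coset_left hz)
            · simpa using Ne.symm he
          · obtain ⟨l, rfl⟩ : ∃ l, j = l + 1 := ⟨j - 1, by omega⟩
            refine hs.stretch (j := 1) (ℓ := l + 1 + 1) (by omega) (by omega)
              (fun l' hl hl' => by simp [show l' ≤ l + 1 by omega])
              (by simpa using mem_coset_self _ _) ?_
              (by simpa using mem_coset_left hz) ?_
            · simpa using hs.mid 0 (s 1) (by omega) (mem_coset_self _ _)
            · simpa using fun hh => hs.mid (l + 1) z (by omega) hh hz
        rcases ih j 0 _ _ _ _ (by omega) htail hone (by simp) (by simp) with hS | hS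
        · rcases hS with ⟨hj, hy⟩ | ⟨hj, y, hy, hy'⟩
          · obtain rfl : j = 0 := by omega
            exact mem_coset_comm (by simpa using hy)
          · exact absurd (by simpa [show 1 ≤ j by omega] using hy')
              (hs.mid 0 y (by omega) (mem_coset_comm (by simpa using hy)))
        · rcases hS with ⟨-, hy⟩ | ⟨hj, -⟩
          · exact mem_coset_comm (by simpa using hy)
          · omega
      · exact Or.inr (Or.inr ⟨hk, y, by simpa using hy, by simpa [show 1 ≤ k by omega] using hy'⟩)
  · rcases ih i j _ _ a b (by omega) hsz hw (by simpa using h0) (by simp) with hS | hS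
    · exact Or.inl (hsS hS)
    · right
      rcases hS with ⟨hk, hy⟩ | ⟨hk, y, hy, hy'⟩
      · obtain rfl : j = 0 := by omega
        exact Or.inr ⟨by omega, z, by simpa using hy, hzj⟩
      · exact Or.inr ⟨by omega, y, by simpa using hy, by simpa [show 1 ≤ j by omega] using hy'⟩

lemma shortens_of_collapses {N M p k : ℕ} (hN : CosetAcyclic E N) (hMN : M ≤ N)
    (ih : ShortensBelow E M) {s r : ℕ → G} {a b : ℕ → Set G} (hs : IsWeakPath E (p + 1) s a)
    (hr : IsWeakPath E (k + 1) r b) (hM : p + 1 + (k + 1) = M) (h0 : s 0 = r 0)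
    (h1 : s (p + 1) = r (k + 1)) (hc : Collapses (p + 1) s a (b 0) (b k)) :
    Shortens (p + 1) s a (a 0 ∩ b 0) ∨ Shortens (k + 1) r b (a 0 ∩ b 0) := by
  rcases hc with hc | ⟨i, hi, z, hz, hz'⟩ | ⟨hp, z, hz, hz'⟩
  · exact Or.inl (Or.inr hc)
  · obtain rfl : p = i + 1 := by omega
    exact shortens_of_last_collapses hN hMN ih hs hr hM h0 h1 hz hz'
  · obtain rfl : p = 0 := by omega
    by_cases hk : k = 0
    · subst hk
      exact Or.inl (Or.inl ⟨rfl, mem_coset_trans hz (mem_coset_symm hz')⟩)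
    obtain ⟨j, rfl⟩ : ∃ j, k = j + 1 := ⟨k - 1, by omega⟩
    by_cases hS : z ∈ coset (r 1) (b 0 ∩ b 1)
    · exact Or.inr (Or.inr ⟨by omega, z, h0 ▸ hz, hS⟩)
    rw [h1] at hz'
    by_cases hT : z ∈ coset (r (j + 1)) (b j ∩ b (j + 1))
    · have := shortens_of_last_collapses hN hMN ih hr hs (by omega) h0.symm h1.symm hT
        (mem_coset_comm hz')
      rw [Set.inter_comm (a 0)]
      exact this.symm
    · have hw := hr.stretch (j := 0) (ℓ := j + 2)
        (q := fun l => if l = 0 then z else if l ≤ j + 1 then r l else z) (by omega) (by omega)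
        (fun l hl hl' => by simp [show l ≤ j + 1 by omega, show l ≠ 0 by omega])
        (by simpa [← h0] using mem_coset_right hz) (by simpa using hS)
        (by simpa using mem_coset_right hz') (by simpa using hT)
      exact absurd (by simp) (IsWeakPath.not_closed hN _ _ _ (by omega) (by omega) hw)

lemma shortens_or_shortens {N p k : ℕ} (hN : CosetAcyclic E N) {s r : ℕ → G}
    {a b : ℕ → Set G} (hs : IsWeakPath E (p + 1) s a) (hr : IsWeakPath E (k + 1) r b)
    (hle : p + 1 + (k + 1) ≤ N) (h0 : s 0 = r 0) (h1 : s (p + 1) = r (k + 1)) :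
    Shortens (p + 1) s a (a 0 ∩ b 0) ∨ Shortens (k + 1) r b (a 0 ∩ b 0) := by
  have main : ∀ M, M ≤ N + 1 → ShortensBelow E M := by
    intro M
    induction M with
    | zero => exact fun _ _ _ _ _ _ _ h => absurd h (Nat.not_lt_zero _)
    | succ M ih =>
      intro hM p k s r a b hlt hs hr h0 h1
      rcases Nat.lt_succ_iff_lt_or_eq.1 hlt with hlt | heq
      · exact ih (by omega) p k s r a b hlt hs hr h0 h1
      rcases collapses_or_collapses hN hs hr (by omega) h0 h1 with hc | hc
      · exact shortens_of_collapses hN (by omega) (ih (by omega)) hs hr heq h0 h1 hc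
      · rw [Set.inter_comm (a 0)]
        exact (shortens_of_collapses hN (by omega) (ih (by omega)) hr hs (by omega)
          h0.symm h1.symm hc).symm
  exact main (N + 1) le_rfl p k s r a b (by omega) hs hr h0 h1

/-- In an acyclic Cayley group the vertices of a weak path are pairwise distinct. -/
lemma IsWeakPath.ne {N ℓ : ℕ} (hN : CosetAcyclic E N) (hℓ : ℓ ≤ N) {s : ℕ → G}
    {a : ℕ → Set G} (h : IsWeakPath E ℓ s a) {i j : ℕ} (hij : i < j) (hj : j ≤ ℓ) :
    s i ≠ s j := by
  obtain ⟨d, rfl⟩ : ∃ d, j = i + d := ⟨j - i, by omega⟩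
  have hfirst : ∀ i, i + 2 ≤ ℓ → s i ∉ coset (s (i + 1)) (a i ∩ a (i + 1)) := by
    rintro (_ | i) hi
    · exact h.first hi
    · exact h.mid i _ (by omega) (mem_coset_self _ _)
  have hlast : ∀ i, i + 2 ≤ ℓ → s (i + 2) ∉ coset (s (i + 1)) (a i ∩ a (i + 1)) := by
    intro i hi hh
    rcases hi.eq_or_lt with he | hlt
    · exact h.last i he.symm hh
    · exact h.mid i _ hlt hh (mem_coset_self _ _)
  rcases (show d = 1 ∨ 2 ≤ d by omega) with rfl | hd
  · intro he
    by_cases hi : i + 2 ≤ ℓ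
    · exact hfirst i hi (he ▸ mem_coset_self _ _)
    · rcases i with _ | i
      · exact h.single (by omega) he
      · refine hlast i (by omega) ?_
        rw [show s (i + 2) = s (i + 1) from he.symm]
        exact mem_coset_self _ _
  · obtain ⟨e, rfl⟩ : ∃ e, d = e + 2 := ⟨d - 2, by omega⟩
    have hw := h.stretch (j := i) (ℓ := e + 2) (q := fun l => s (l + i)) (by omega) (by omega)
      (fun _ _ _ => rfl) (by simpa using mem_coset_self _ _) (by simpa using hfirst i (by omega))
      (mem_coset_self _ _) (by
        have := hlast (e + i) (by omega)
        rw [show e + i + 2 = e + 2 + i by omega, show e + i + 1 = e + 1 + i by omega] at this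
        exact this)
    have := IsWeakPath.not_closed hN _ _ _ (by omega) (by omega) hw
    rw [add_comm i]
    simpa using this.symm

lemma IsWeakPath.isCosetPath {N ℓ : ℕ} (hN : CosetAcyclic E N) (h1 : 1 ≤ ℓ) (hℓ : ℓ ≤ N)
    {s : ℕ → G} {a : ℕ → Set G} (h : IsWeakPath E ℓ s a) :
    IsCosetPath E ℓ (fun i => s (i - 1)) (fun i => a (i - 1)) := by
  refine ⟨h1, fun i hi hi' => h.sub _ (by omega), fun i j hi hij hj he => ?_,
    fun i hi hi' => ?_, fun i hi hi' => ?_⟩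
  · exact absurd he (h.ne hN hℓ (by omega) (by omega))
  · have := h.link (i - 1) (by omega)
    rwa [show i - 1 + 1 = i + 1 - 1 by omega] at this
  · rw [Set.eq_empty_iff_forall_notMem]
    rintro z ⟨hz, hz'⟩
    simp only [extLabel, Nat.add_sub_cancel] at hz hz'
    rcases (show i = 1 ∨ 2 ≤ i by omega) with rfl | hi2
    · simp only [Nat.sub_self, show ¬ (1 ≤ 0) by omega, false_and, if_false,
        Set.empty_inter, mem_coset_empty] at hz
      subst hz
      split_ifs at hz' with hc
      · exact h.first (by omega) hz'
      · rw [Set.inter_empty, mem_coset_empty] at hz'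
        exact h.single (by omega) hz'
    · obtain ⟨p, rfl⟩ : ∃ p, i = p + 2 := ⟨i - 2, by omega⟩
      rw [if_pos (by omega)] at hz
      simp only [show p + 2 - 1 = p + 1 by omega, Nat.add_sub_cancel] at hz hz'
      split_ifs at hz' with hc
      · exact h.mid p z (by omega) hz hz'
      · rw [Set.inter_empty, mem_coset_empty] at hz'
        exact h.last p (by omega) (hz' ▸ hz)

lemma IsWeakPath.exists_isCosetPath_of_shortens {N p : ℕ} (hN : CosetAcyclic E N)
    (hp : p + 1 ≤ N) {s : ℕ → G} {a : ℕ → Set G} (h : IsWeakPath E (p + 1) s a) {γ : Set G}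
    (hγ : γ ⊆ a 0) (hS : Shortens (p + 1) s a γ) :
    ∃ (w : ℕ → G) (δ : ℕ → Set G), IsCosetPath E (p + 1) w δ ∧ w 1 = s 0 ∧
      w (p + 1 + 1) = s (p + 1) ∧ δ 1 = γ := by
  suffices hw : ∃ (w : ℕ → G) (δ : ℕ → Set G), IsWeakPath E (p + 1) w δ ∧ w 0 = s 0 ∧
      w (p + 1) = s (p + 1) ∧ δ 0 = γ by
    obtain ⟨w, δ, hw, h0, h1, h2⟩ := hw
    exact ⟨_, _, hw.isCosetPath hN (by omega) hp, by simpa using h0, by simpa using h1,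
      by simpa using h2⟩
  have hγE : γ ⊆ E := hγ.trans (h.sub 0 (by omega))
  rcases hS with ⟨hp1, hy⟩ | ⟨hp2, y, hy, hy'⟩
  · obtain rfl : p = 0 := by omega
    exact ⟨s, fun _ => γ, isWeakPath_one hγE hy (h.single rfl), rfl, rfl, rfl⟩
  · refine ⟨fun i => if i = 1 then y else s i, fun i => if i = 0 then γ else a i,
      ⟨fun i hi => ?_, fun i hi => ?_, fun i z hi hz hz' => ?_, fun _ hz => ?_,
        fun i hi hz => ?_, fun h1 => by omega⟩, by simp, by simp; omega, by simp⟩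
    · split_ifs
      · exact hγE
      · exact h.sub i hi
    · rcases i with _ | _ | i
      · simpa using hy
      · simpa using mem_coset_trans (mem_coset_symm (mem_coset_right hy')) (h.link 1 hi)
      · simpa using h.link _ hi
    · rcases i with _ | i
      · simp only [zero_add, if_true, one_ne_zero, if_false, OfNat.ofNat_ne_zero,
          OfNat.ofNat_ne_one] at hz hz'
        exact h.mid 0 z hi (mem_coset_trans hy'
          (mem_coset_mono hz (Set.inter_subset_inter_left _ hγ))) hz'
      · simp at hz hz'
        exact h.mid (i + 1) z hi hz hz'
    · simp only [if_true, one_ne_zero, zero_ne_one, if_false] at hz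
      exact h.first hp2 (mem_coset_trans hy'
        (mem_coset_mono hz (Set.inter_subset_inter_left _ hγ)))
    · rcases i with _ | i
      · simp only [zero_add, if_true, one_ne_zero, if_false, OfNat.ofNat_ne_one] at hz
        exact h.last 0 hi (mem_coset_trans hy'
          (mem_coset_mono hz (Set.inter_subset_inter_left _ hγ)))
      · simp at hz
        exact h.last (i + 1) hi hz

end CosetPaths

/-- in a coset `2n`-acyclic Cayley group, if there are two coset paths
from `v` to `u` of lengths `ℓ, k ≤ n` with first labels `α 1` and `β 1`, then there is
a coset path from `v` to `u` of length `≤ n` whose first label is `α 1 ∩ β 1`. -/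
theorem exists_path_first_label_inter {G : Type*} [Group G] (n : ℕ) (E : Set G)
    (hC : IsCayley E) (hacyc : CosetAcyclic E (2 * n)) (v u : G)
    (ℓ k : ℕ) (hℓ : ℓ ≤ n) (hk : k ≤ n)
    (t : ℕ → G) (α : ℕ → Set G) (hp1 : IsCosetPath E ℓ t α)
    (ht1 : t 1 = v) (ht2 : t (ℓ + 1) = u)
    (r : ℕ → G) (β : ℕ → Set G) (hp2 : IsCosetPath E k r β)
    (hr1 : r 1 = v) (hr2 : r (k + 1) = u) :
    ∃ (ℓ' : ℕ) (w : ℕ → G) (δ : ℕ → Set G),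
      ℓ' ≤ n ∧ IsCosetPath E ℓ' w δ ∧ w 1 = v ∧ w (ℓ' + 1) = u ∧ δ 1 = α 1 ∩ β 1 := by
  have hα := hp1.isWeakPath
  have hβ := hp2.isWeakPath
  obtain ⟨p, rfl⟩ : ∃ p, ℓ = p + 1 := ⟨ℓ - 1, by have := hp1.1; omega⟩
  obtain ⟨q, rfl⟩ : ∃ q, k = q + 1 := ⟨k - 1, by have := hp2.1; omega⟩
  rcases shortens_or_shortens hacyc hα hβ (by omega) (ht1.trans hr1.symm) (ht2.trans hr2.symm)
    with hS | hS
  · obtain ⟨w, δ, hw, h0, h1, h2⟩ :=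
      hα.exists_isCosetPath_of_shortens hacyc (by omega) Set.inter_subset_left hS
    exact ⟨p + 1, w, δ, hℓ, hw, h0.trans ht1, h1.trans ht2, h2⟩
  · obtain ⟨w, δ, hw, h0, h1, h2⟩ :=
      hβ.exists_isCosetPath_of_shortens hacyc (by omega) Set.inter_subset_right hS
    exact ⟨q + 1, w, δ, hk, hw, h0.trans hr1, h1.trans hr2, h2⟩
end
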